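/- arXiv:1110.5202 — 4 statements merged into one kernel-verified Lean document; each statement's English description precedes it below -/
import Mathlib

section
/- Let N ≥ 1, set t_i = i/N for i = 0,…,N, let x : [0,1] → ℝ be continuous, and let (πₙ) be a sequence of partitions of [0,1] with mesh |πₙ| → 0. Define the piecewise integrand ψ(s) = Σ_{i=1}^N (s − t_{i−1})·1_{(t_{i−1}, t_i]}(s). Then the forward Riemann sums of ψ against x along (πₙ) converge, and the discrete average satisfies the pathwise replication identity (1/(N+1)) Σ_{j=0}^N x(j/N) = x(0)/(N+1) + (N/(N+1)) · lim_{n→∞} Σ_{t_j^n ∈ πₙ ∩ (0,1]} ψ(t_{j−1}^n)(x(t_j^n) − x(t_{j−1}^n)) + (N/(N+1)) ∫₀^1 x(s) ds. -/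
open Filter MeasureTheory Set

/-- A sequence of partitions of `[0, T]` with mesh tending to `0`.
For each `n`, the partition is `0 = τ n 0 < τ n 1 < ⋯ < τ n (k n) = T`. -/
structure PartitionSeq (T : ℝ) where
  k : ℕ → ℕ
  τ : ℕ → ℕ → ℝ
  k_pos : ∀ n, 0 < k n
  first : ∀ n, τ n 0 = 0
  last : ∀ n, τ n (k n) = T
  mono : ∀ n, StrictMonoOn (τ n) (Set.Iic (k n))
  mesh : ∀ ε > 0, ∃ N, ∀ n ≥ N, ∀ j < k n, τ n (j + 1) - τ n j < ε

/-- Forward Riemann sum of `y` against `x` along the partition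
`τ 0 < τ 1 < ⋯ < τ k`, up to time `t`:
`Σ_{τ (j+1) ≤ t} y (τ j) * (x (τ (j+1)) - x (τ j))`. -/
noncomputable def fwdSum (k : ℕ) (τ : ℕ → ℝ) (y x : ℝ → ℝ) (t : ℝ) : ℝ :=
  ∑ j ∈ Finset.range k, if τ (j + 1) ≤ t then y (τ j) * (x (τ (j + 1)) - x (τ j)) else 0

/-- Quadratic variation sum of the path `x` along the partition
`τ 0 < τ 1 < ⋯ < τ k`, up to time `t`. -/
noncomputable def quadSum (k : ℕ) (τ : ℕ → ℝ) (x : ℝ → ℝ) (t : ℝ) : ℝ :=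
  ∑ j ∈ Finset.range k, if τ (j + 1) ≤ t then (x (τ (j + 1)) - x (τ j)) ^ 2 else 0

theorem fwdSum_sub (k : ℕ) (τ : ℕ → ℝ) (y z x : ℝ → ℝ) (t : ℝ) :
    fwdSum k τ (fun s => y s - z s) x t = fwdSum k τ y x t - fwdSum k τ z x t := by
  unfold fwdSum
  rw [← Finset.sum_sub_distrib]
  refine Finset.sum_congr rfl fun j _ => ?_
  split_ifs <;> ring

theorem fwdSum_const_mul (k : ℕ) (τ : ℕ → ℝ) (c : ℝ) (y x : ℝ → ℝ) (t : ℝ) :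
    fwdSum k τ (fun s => c * y s) x t = c * fwdSum k τ y x t := by
  unfold fwdSum
  rw [Finset.mul_sum]
  refine Finset.sum_congr rfl fun j _ => ?_
  split_ifs <;> ring

theorem fwdSum_finset_sum {ι : Type*} (A : Finset ι) (k : ℕ) (τ : ℕ → ℝ) (y : ι → ℝ → ℝ)
    (x : ℝ → ℝ) (t : ℝ) :
    fwdSum k τ (fun s => ∑ i ∈ A, y i s) x t = ∑ i ∈ A, fwdSum k τ (y i) x t := by
  unfold fwdSum
  rw [Finset.sum_comm]
  refine Finset.sum_congr rfl fun j _ => ?_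
  split_ifs
  · rw [Finset.sum_mul]
  · simp

namespace PartitionSeq

variable {T : ℝ} (P : PartitionSeq T)

theorem mem_Icc (n j : ℕ) (hj : j ≤ P.k n) : P.τ n j ∈ Icc 0 T := by
  have hm := (P.mono n).monotoneOn
  constructor
  · rw [← P.first n]
    exact hm (Nat.zero_le _) hj (Nat.zero_le _)
  · exact (hm hj (le_refl (P.k n)) hj).trans_eq (P.last n)

theorem lt_succ (n j : ℕ) (hj : j < P.k n) : P.τ n j < P.τ n (j + 1) :=
  P.mono n hj.le (Nat.succ_le_of_lt hj) (Nat.lt_succ_self j)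

/-- Summation by parts for forward Riemann sums. -/
theorem fwdSum_eq (n : ℕ) (y x : ℝ → ℝ) :
    fwdSum (P.k n) (P.τ n) y x T = y T * x T - y 0 * x 0 -
      ∑ j ∈ Finset.range (P.k n), x (P.τ n (j + 1)) * (y (P.τ n (j + 1)) - y (P.τ n j)) := by
  have h := Finset.sum_range_sub (fun j => y (P.τ n j) * x (P.τ n j)) (P.k n)
  simp only [P.first, P.last] at h
  rw [← h, ← Finset.sum_sub_distrib]
  unfold fwdSum
  refine Finset.sum_congr rfl fun j hj => ?_
  rw [if_pos (P.mem_Icc n (j + 1) (Finset.mem_range.1 hj)).2]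
  ring

/-- If `F` is an indefinite Stieltjes integral of the continuous path `x` against `y`, then the
forward Riemann sums of `y` against `x` converge to the value given by integration by parts. -/
theorem tendsto_fwdSum {x y F : ℝ → ℝ} (hx : ContinuousOn x (Icc 0 T))
    (hF : ∀ ε > 0, ∀ u v, 0 ≤ u → u < v → v ≤ T → (∀ s ∈ Icc u v, |x v - x s| ≤ ε) →
      |x v * (y v - y u) - (F v - F u)| ≤ ε * (y v - y u)) :
    Tendsto (fun n => fwdSum (P.k n) (P.τ n) y x T) atTop
      (nhds (y T * x T - y 0 * x 0 - (F T - F 0))) := by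
  have hu := isCompact_Icc.uniformContinuousOn_of_continuous hx
  rw [Metric.uniformContinuousOn_iff] at hu
  simp only [fwdSum_eq]
  refine tendsto_const_nhds.sub ?_
  rw [Metric.tendsto_atTop]
  intro ε hε
  have hC : 0 < |y T - y 0| + 1 := by positivity
  obtain ⟨δ, hδ, hxδ⟩ := hu (ε / (|y T - y 0| + 1)) (by positivity)
  obtain ⟨M, hM⟩ := P.mesh δ hδ
  refine ⟨M, fun n hn => ?_⟩
  have hFs := Finset.sum_range_sub (fun j => F (P.τ n j)) (P.k n)
  have hys := Finset.sum_range_sub (fun j => y (P.τ n j)) (P.k n)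
  simp only [P.first, P.last] at hFs hys
  rw [Real.dist_eq, ← hFs, ← Finset.sum_sub_distrib]
  calc _ ≤ ∑ j ∈ Finset.range (P.k n),
        ε / (|y T - y 0| + 1) * (y (P.τ n (j + 1)) - y (P.τ n j)) := by
        refine (Finset.abs_sum_le_sum_abs _ _).trans (Finset.sum_le_sum fun j hj => ?_)
        have hj := Finset.mem_range.1 hj
        have h0 := P.mem_Icc n j hj.le
        have h1 := P.mem_Icc n (j + 1) hj
        refine hF _ (by positivity) _ _ h0.1 (P.lt_succ n j hj) h1.2 fun s hs => ?_
        refine (hxδ _ h1 s ⟨h0.1.trans hs.1, hs.2.trans h1.2⟩ ?_).le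
        rw [Real.dist_eq, abs_of_nonneg (by linarith [hs.2])]
        linarith [hM n hn j hj, hs.1]
    _ = ε / (|y T - y 0| + 1) * (y T - y 0) := by rw [← Finset.mul_sum, hys]
    _ ≤ ε / (|y T - y 0| + 1) * |y T - y 0| := by gcongr; exact le_abs_self _
    _ < ε / (|y T - y 0| + 1) * (|y T - y 0| + 1) := by gcongr; linarith
    _ = ε := by field_simp

/-- Forward Riemann sums of the indicator of `(c, ∞)`. -/
theorem tendsto_fwdSum_indicator {x : ℝ → ℝ} (hx : ContinuousOn x (Icc 0 T)) {c : ℝ}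
    (hc : c ∈ Icc 0 T) :
    Tendsto (fun n => fwdSum (P.k n) (P.τ n) (fun s => if c < s then 1 else 0) x T) atTop
      (nhds (x T - x c)) := by
  have h := P.tendsto_fwdSum (y := fun s => if c < s then 1 else 0)
    (F := fun s => x c * (if c < s then 1 else 0)) hx ?_
  · convert h using 2
    rw [if_neg hc.1.not_gt]
    rcases hc.2.eq_or_lt with rfl | h
    · simp
    · rw [if_pos h]
      ring
  · intro ε hε u v hu huv hv hs
    by_cases h1 : c < v
    · by_cases h2 : c < u
      · simp [h1, h2]
      · simpa [h1, h2] using hs c ⟨not_lt.1 h2, h1.le⟩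
    · have h2 : ¬ c < u := fun h => h1 (h.trans huv)
      simp [h1, h2]

/-- Forward Riemann sums of the positive part of `s - c`. -/
theorem tendsto_fwdSum_posPart {x : ℝ → ℝ} (hx : ContinuousOn x (Icc 0 T)) {c : ℝ}
    (hc : c ∈ Icc 0 T) :
    Tendsto (fun n => fwdSum (P.k n) (P.τ n) (fun s => max s c - c) x T) atTop
      (nhds ((T - c) * x T - ∫ s in c..T, x s)) := by
  have hint : ∀ u ∈ Icc 0 T, ∀ v ∈ Icc 0 T, IntervalIntegrable x volume u v := fun u hu v hv =>
    (hx.mono (ordConnected_Icc.uIcc_subset hu hv)).intervalIntegrable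
  have h := P.tendsto_fwdSum (y := fun s => max s c - c) (F := fun s => ∫ r in c..max s c, x r) hx ?_
  · convert h using 2
    simp [max_eq_left hc.2, max_eq_right hc.1]
  · intro ε hε u v hu huv hv hs
    have hu' : max u c ∈ Icc 0 T := ⟨le_max_of_le_left hu, max_le (huv.le.trans hv) hc.2⟩
    have hv' : max v c ∈ Icc 0 T := ⟨le_max_of_le_left (hu.trans huv.le), max_le hv hc.2⟩
    have huv' : max u c ≤ max v c := max_le_max_right c huv.le
    have hb : ‖∫ r in max u c..max v c, (x v - x r)‖ ≤ ε * |max v c - max u c| := by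
      refine intervalIntegral.norm_integral_le_of_norm_le_const fun r hr => ?_
      rw [uIoc_of_le huv', mem_Ioc, max_lt_iff, le_max_iff] at hr
      exact hs r ⟨hr.1.1.le, hr.2.resolve_right hr.1.2.not_ge⟩
    rw [intervalIntegral.integral_sub intervalIntegrable_const (hint _ hu' _ hv'),
      intervalIntegral.integral_const, smul_eq_mul, Real.norm_eq_abs,
      abs_of_nonneg (sub_nonneg.2 huv')] at hb
    rw [intervalIntegral.integral_interval_sub_left (hint _ hc _ hv') (hint _ hc _ hu')]
    convert hb using 2 <;> ring

/-- Forward Riemann sums of `(s - a) 1_{(a, b]}(s)`. -/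
theorem tendsto_fwdSum_ramp {x : ℝ → ℝ} (hx : ContinuousOn x (Icc 0 T)) {a b : ℝ}
    (ha : a ∈ Icc 0 T) (hb : b ∈ Icc 0 T) (hab : a ≤ b) :
    Tendsto (fun n => fwdSum (P.k n) (P.τ n) (fun s => if a < s ∧ s ≤ b then s - a else 0) x T)
      atTop (nhds ((b - a) * x b - ∫ s in a..b, x s)) := by
  have hint : ∀ u ∈ Icc 0 T, ∀ v ∈ Icc 0 T, IntervalIntegrable x volume u v := fun u hu v hv =>
    (hx.mono (ordConnected_Icc.uIcc_subset hu hv)).intervalIntegrable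
  have hT : T ∈ Icc 0 T := ⟨ha.1.trans ha.2, le_rfl⟩
  have hy : (fun s : ℝ => if a < s ∧ s ≤ b then s - a else 0) = fun s =>
      (max s a - a) - (max s b - b) - (b - a) * (if b < s then 1 else 0) := by
    funext s
    rcases le_or_gt s a with h1 | h1
    · have h2 := h1.trans hab
      simp [h1, h2, h1.not_gt, h2.not_gt]
    · rcases le_or_gt s b with h2 | h2
      · simp [h1, h2, h1.le, h2.not_gt]
      · simp [h1.le, h2, h2.le, h2.not_ge]
  have h := ((P.tendsto_fwdSum_posPart hx ha).sub (P.tendsto_fwdSum_posPart hx hb)).sub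
    ((P.tendsto_fwdSum_indicator hx hb).const_mul (b - a))
  simp only [hy, fwdSum_sub, fwdSum_const_mul] at h ⊢
  convert h using 2
  rw [← intervalIntegral.integral_add_adjacent_intervals (hint a ha b hb) (hint b hb T hT)]
  ring

end PartitionSeq

/-- Pathwise replication of the discrete average sampled at `t_i = i / N`,
`i = 0, …, N`, on `[0, 1]`: the forward Riemann sums of the piecewise
integrand `ψ s = Σ_{i=1}^N (s - t_{i-1}) 1_{(t_{i-1}, t_i]}(s)` against a
continuous path `x` converge to some limit `L`, and
`(1/(N+1)) Σ_{j=0}^N x (j/N) = x 0 / (N+1) + (N/(N+1)) L + (N/(N+1)) ∫₀^1 x s ds`. -/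
theorem discrete_average_replication
    (N : ℕ) (hN : 1 ≤ N) (x : ℝ → ℝ)
    (hx : ContinuousOn x (Set.Icc 0 1))
    (P : PartitionSeq 1) :
    ∃ L : ℝ,
      Tendsto (fun n => fwdSum (P.k n) (P.τ n)
          (fun s => ∑ i ∈ Finset.Icc 1 N,
            if ((i : ℝ) - 1) / N < s ∧ s ≤ (i : ℝ) / N then s - ((i : ℝ) - 1) / N else 0)
          x 1) atTop (nhds L) ∧
      (1 / ((N : ℝ) + 1)) * ∑ j ∈ Finset.range (N + 1), x ((j : ℝ) / N)
        = x 0 / ((N : ℝ) + 1) + ((N : ℝ) / ((N : ℝ) + 1)) * L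
          + ((N : ℝ) / ((N : ℝ) + 1)) * ∫ s in (0 : ℝ)..1, x s := by
  have hN0 : (0 : ℝ) < N := by exact_mod_cast hN
  have hmem : ∀ i ≤ N, (i : ℝ) / N ∈ Icc (0 : ℝ) 1 := fun i hi =>
    ⟨by positivity, div_le_one_of_le₀ (by exact_mod_cast hi) hN0.le⟩
  have hsum : ∑ i ∈ Finset.range N, (∫ s in ((i : ℕ) : ℝ) / N..((i + 1 : ℕ) : ℝ) / N, x s)
      = ∫ s in (0 : ℝ)..1, x s := by
    have h := intervalIntegral.sum_integral_adjacent_intervals (f := x) (μ := volume)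
      (a := fun i : ℕ => (i : ℝ) / N) (n := N) fun i hi =>
        (hx.mono (ordConnected_Icc.uIcc_subset (hmem i hi.le) (hmem (i + 1) hi))).intervalIntegrable
    simpa [hN0.ne'] using h
  refine ⟨(1 / N) * ∑ i ∈ Finset.range N, x (((i + 1 : ℕ) : ℝ) / N) - ∫ s in (0 : ℝ)..1, x s,
    ?_, ?_⟩
  · rw [← hsum, Finset.mul_sum, ← Finset.sum_sub_distrib]
    have hIcc : Finset.Icc 1 N = Finset.Ico (0 + 1) (N + 1) := by
      ext i
      simp
    simp only [fwdSum_finset_sum, hIcc, ← Finset.sum_Ico_add', ← Finset.range_eq_Ico]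
    refine tendsto_finsetSum _ fun i hi => ?_
    have hi := Finset.mem_range.1 hi
    have h := P.tendsto_fwdSum_ramp hx (hmem i hi.le) (hmem (i + 1) hi)
      (by gcongr; exact Nat.le_succ i)
    have hd : ((i + 1 : ℕ) : ℝ) / N - (i : ℝ) / N = 1 / N := by
      push_cast
      ring
    have hs : ((i + 1 : ℕ) : ℝ) - 1 = i := by
      push_cast
      ring
    rw [hd] at h
    simpa only [hs] using h
  · rw [Finset.sum_range_succ']
    simp only [Nat.cast_zero, zero_div]
    field_simp
    ring
end

section
/- Let T > 0 and let (πₙ) be a sequence of partitions of [0,T] with mesh |πₙ| → 0. Let x : [0,T] → ℝ have quadratic variation q along (πₙ), and let z : [0,T] → ℝ have zero quadratic variation along (πₙ). Then the sum x + z has quadratic variation q along (πₙ): for every t ∈ [0,T], Σ_{t_j^n ∈ πₙ ∩ (0,t]} ((x+z)(t_j^n) − (x+z)(t_{j−1}^n))² → q(t) as n → ∞. (This is the basis of mixed models: adding a zero quadratic variation process to a price process does not change its quadratic variation.) -/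
open Filter MeasureTheory Set

/-- The cross terms in the quadratic variation sum of `x + z` are controlled, by the
Cauchy-Schwarz inequality, by the quadratic variation sums of `x` and `z`. -/
theorem abs_quadSum_add_sub_le (k : ℕ) (τ : ℕ → ℝ) (x z : ℝ → ℝ) (t : ℝ) :
    |quadSum k τ (fun s => x s + z s) t - quadSum k τ x t - quadSum k τ z t| ≤
      2 * √(quadSum k τ x t * quadSum k τ z t) := by
  simp only [quadSum, ← Finset.sum_filter]
  set A := (Finset.range k).filter fun j => τ (j + 1) ≤ t
  have hcross : ∑ j ∈ A, (x (τ (j + 1)) + z (τ (j + 1)) - (x (τ j) + z (τ j))) ^ 2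
      - ∑ j ∈ A, (x (τ (j + 1)) - x (τ j)) ^ 2 - ∑ j ∈ A, (z (τ (j + 1)) - z (τ j)) ^ 2
      = 2 * ∑ j ∈ A, (x (τ (j + 1)) - x (τ j)) * (z (τ (j + 1)) - z (τ j)) := by
    rw [← Finset.sum_sub_distrib, ← Finset.sum_sub_distrib, Finset.mul_sum]
    exact Finset.sum_congr rfl fun j _ => by ring
  rw [hcross, abs_mul, abs_two]
  gcongr
  exact Real.abs_le_sqrt (Finset.sum_mul_sq_le_sq_mul_sq A _ _)

/-- Adding a zero quadratic variation path `z` to a path `x` with quadratic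
variation `q` along a partition sequence `P` yields a path `x + z` with the
same quadratic variation `q` along `P`. -/
theorem quadratic_variation_add_zero_qv
    (T : ℝ) (hT : 0 < T) (P : PartitionSeq T)
    (x z q : ℝ → ℝ) (hq_cont : Continuous q)
    (hx : ∀ t ∈ Set.Icc (0 : ℝ) T,
      Tendsto (fun n => quadSum (P.k n) (P.τ n) x t) atTop (nhds (q t)))
    (hz : ∀ t ∈ Set.Icc (0 : ℝ) T,
      Tendsto (fun n => quadSum (P.k n) (P.τ n) z t) atTop (nhds 0))
    (t : ℝ) (ht : t ∈ Set.Icc 0 T) :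
    Tendsto (fun n => quadSum (P.k n) (P.τ n) (fun s => x s + z s) t) atTop (nhds (q t)) := by
  have hbound : Tendsto (fun n => 2 * √(quadSum (P.k n) (P.τ n) x t * quadSum (P.k n) (P.τ n) z t))
      atTop (nhds 0) := by
    simpa using ((hx t ht).mul (hz t ht)).sqrt.const_mul 2
  have hcross := squeeze_zero_norm
    (fun n => (Real.norm_eq_abs _).trans_le (abs_quadSum_add_sub_le (P.k n) (P.τ n) x z t)) hbound
  simpa using (hcross.add (hz t ht)).add (hx t ht)
end

section
/- Let T > 0, let (πₙ) be a sequence of partitions of [0,T] with mesh |πₙ| → 0, and let x : [0,T] → ℝ be a continuous path having quadratic variation q along (πₙ). Then for every continuous function g : ℝ → ℝ and every t ∈ [0,T], the weighted quadratic sums converge: Σ_{t_j^n ∈ πₙ ∩ (0,t]} g(x(t_{j−1}^n)) (x(t_j^n) − x(t_{j−1}^n))² → ∫_{(0,t]} g(x(s)) dμ_q(s) as n → ∞. -/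
open Filter MeasureTheory Set

/-- Weighted quadratic variation sum of `x` with weight `g`, along the
partition `τ 0 < ⋯ < τ k`, up to time `t`:
`Σ_{τ (j+1) ≤ t} g (x (τ j)) * (x (τ (j+1)) - x (τ j))²`. -/
noncomputable def wQuadSum (k : ℕ) (τ : ℕ → ℝ) (g x : ℝ → ℝ) (t : ℝ) : ℝ :=
  ∑ j ∈ Finset.range k,
    if τ (j + 1) ≤ t then g (x (τ j)) * (x (τ (j + 1)) - x (τ j)) ^ 2 else 0

lemma PartitionSeq.mem_Icc_s8 {T : ℝ} (P : PartitionSeq T) (n : ℕ) {j : ℕ} (hj : j ≤ P.k n) :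
    P.τ n j ∈ Icc 0 T := by
  have hmono := (P.mono n).monotoneOn
  constructor
  · rw [← P.first n]
    exact hmono (mem_Iic.2 (Nat.zero_le _)) (mem_Iic.2 hj) (Nat.zero_le _)
  · exact (hmono (mem_Iic.2 hj) (mem_Iic.2 le_rfl) hj).trans_eq (P.last n)

/-- The increment of the weighted sum over `(a, b]` is close to a multiple of the increment of the
unweighted sum when the weights are close to a constant. -/
lemma abs_wQuadSum_sub_sub_mul_le {k : ℕ} {τ : ℕ → ℝ} {g x : ℝ → ℝ} {a b c ε : ℝ} (hab : a ≤ b)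
    (h : ∀ j < k, a < τ (j + 1) → τ (j + 1) ≤ b → |g (x (τ j)) - c| ≤ ε) :
    |wQuadSum k τ g x b - wQuadSum k τ g x a - c * (quadSum k τ x b - quadSum k τ x a)| ≤
      ε * (quadSum k τ x b - quadSum k τ x a) := by
  simp only [wQuadSum, quadSum, ← Finset.sum_sub_distrib, Finset.mul_sum]
  refine (Finset.abs_sum_le_sum_abs _ _).trans (Finset.sum_le_sum fun j hj => ?_)
  by_cases ha : τ (j + 1) ≤ a
  · simp [ha, ha.trans hab]
  by_cases hb : τ (j + 1) ≤ b
  · simp only [ha, hb, if_true, if_false, sub_zero, ← sub_mul, abs_mul, abs_sq]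
    exact mul_le_mul_of_nonneg_right (h j (Finset.mem_range.1 hj) (not_le.1 ha) hb) (sq_nonneg _)
  · simp [ha, hb]

lemma wQuadSum_zero {T : ℝ} (P : PartitionSeq T) (n : ℕ) (g x : ℝ → ℝ) :
    wQuadSum (P.k n) (P.τ n) g x 0 = 0 := by
  refine Finset.sum_eq_zero fun j hj => if_neg (not_le.2 ?_)
  have hj' := Finset.mem_range.1 hj
  exact (P.mem_Icc_s8 n hj'.le).1.trans_lt
    (P.mono n (mem_Iic.2 hj'.le) (mem_Iic.2 hj') (Nat.lt_succ_self j))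

lemma abs_setIntegral_sub_mul_le {μ : Measure ℝ} {f : ℝ → ℝ} {s : Set ℝ} {c ε : ℝ}
    (hμ : μ s ≠ ⊤) (hf : IntegrableOn f s μ)
    (h : ∀ u ∈ s, ‖f u - c‖ ≤ ε) :
    |∫ u in s, f u ∂μ - c * μ.real s| ≤ ε * μ.real s := by
  have hc : ∫ u in s, (f u - c) ∂μ = ∫ u in s, f u ∂μ - c * μ.real s := by
    rw [integral_sub hf (integrableOn_const hμ), setIntegral_const, smul_eq_mul, mul_comm]
  rw [← hc]
  exact norm_setIntegral_le_of_norm_le_const hμ.lt_top h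

/-- A property holding at `0` and propagating over steps shorter than `δ` holds on `[0, T]`. -/
lemma forall_mem_Icc_of_short_steps {p : ℝ → Prop} {T δ : ℝ} (hδ : 0 < δ) (h0 : p 0)
    (hstep : ∀ a b, 0 ≤ a → a ≤ b → b ≤ T → b - a < δ → p a → p b) :
    ∀ t ∈ Icc 0 T, p t := by
  rintro t ⟨ht0, htT⟩
  obtain ⟨m, hm⟩ := exists_nat_gt (t / δ)
  have hm0 : (0 : ℝ) < m := (div_nonneg ht0 hδ.le).trans_lt hm
  have hd : 0 ≤ t / m := div_nonneg ht0 hm0.le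
  have key : ∀ i : ℕ, i ≤ m → p (i * (t / m)) := by
    intro i
    induction i with
    | zero => simpa using h0
    | succ i ih =>
      intro hi
      refine hstep (i * (t / m)) _ (by positivity) ?_ ?_ ?_ (ih (by omega))
      · push_cast
        linarith
      · refine le_trans ?_ htT
        calc ((i + 1 : ℕ) : ℝ) * (t / m) ≤ m * (t / m) := by gcongr
          _ = t := mul_div_cancel₀ t hm0.ne'
      · have : t / m < δ := by
          rw [div_lt_iff₀ hm0]
          rwa [div_lt_iff₀ hδ, mul_comm] at hm
        push_cast
        linarith
  have := key m le_rfl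
  rwa [mul_div_cancel₀ t hm0.ne'] at this

lemma isFiniteMeasureOnCompacts_of_Ioc {μ : Measure ℝ} (h : ∀ a b, a ≤ b → μ (Ioc a b) ≠ ⊤) :
    IsFiniteMeasureOnCompacts μ := by
  refine ⟨fun K hK => ?_⟩
  obtain ⟨r, hr, hKr⟩ := hK.isBounded.subset_closedBall_lt 0 0
  refine (measure_mono (t := Ioc (-r - 1) r) fun u hu => ?_).trans_lt
    (h (-r - 1) r (by linarith)).lt_top
  have := hKr hu
  rw [Real.closedBall_eq_Icc] at this
  exact ⟨by linarith [this.1], by linarith [this.2]⟩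

/-- If the continuous path `x` has quadratic variation `q` along the partition
sequence `P` (with `μq` the Lebesgue–Stieltjes measure of `q`), then for every
continuous `g : ℝ → ℝ` and `t ∈ [0, T]` the weighted quadratic sums converge:
`Σ g (x (t_{j-1}ⁿ)) (x (t_jⁿ) - x (t_{j-1}ⁿ))² → ∫_{(0,t]} g (x s) dμq`. -/
theorem weighted_quadratic_sums_tendsto
    (T : ℝ) (hT : 0 < T) (P : PartitionSeq T)
    (x : ℝ → ℝ) (hx : ContinuousOn x (Set.Icc 0 T))
    (q : ℝ → ℝ) (hq_cont : Continuous q) (hq_mono : Monotone q) (hq0 : q 0 = 0)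
    (hqv : ∀ t ∈ Set.Icc (0 : ℝ) T,
      Tendsto (fun n => quadSum (P.k n) (P.τ n) x t) atTop (nhds (q t)))
    (μq : Measure ℝ)
    (hμq : ∀ a b : ℝ, a ≤ b → μq (Set.Ioc a b) = ENNReal.ofReal (q b - q a))
    (g : ℝ → ℝ) (hg : Continuous g)
    (t : ℝ) (ht : t ∈ Set.Icc 0 T) :
    Tendsto (fun n => wQuadSum (P.k n) (P.τ n) g x t) atTop
      (nhds (∫ s in Set.Ioc (0 : ℝ) t, g (x s) ∂μq)) := by
  have hμ_top : ∀ a b, a ≤ b → μq (Ioc a b) ≠ ⊤ := fun a b hab => by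
    rw [hμq a b hab]
    exact ENNReal.ofReal_ne_top
  have hμ_real : ∀ a b, a ≤ b → μq.real (Ioc a b) = q b - q a := fun a b hab => by
    rw [Measure.real, hμq a b hab, ENNReal.toReal_ofReal (sub_nonneg.2 (hq_mono hab))]
  have := isFiniteMeasureOnCompacts_of_Ioc hμ_top
  have hf : ContinuousOn (fun s => g (x s)) (Icc 0 T) := hg.comp_continuousOn hx
  have hint : ∀ a b, 0 ≤ a → b ≤ T → IntegrableOn (fun s => g (x s)) (Ioc a b) μq :=
    fun a b ha hb => (hf.integrableOn_compact isCompact_Icc).mono_set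
      (Ioc_subset_Icc_self.trans (Icc_subset_Icc ha hb))
  have huc := isCompact_Icc.uniformContinuousOn_of_continuous hf
  rw [Metric.uniformContinuousOn_iff_le] at huc
  -- Up to any `η > 0`, the limiting error at time `s` is at most `2 * ε * q s`.
  have main : ∀ ε > 0, ∀ s ∈ Icc 0 T, ∀ η > 0, ∀ᶠ n in atTop,
      |wQuadSum (P.k n) (P.τ n) g x s - ∫ u in Ioc 0 s, g (x u) ∂μq| < 2 * ε * q s + η := by
    intro ε hε
    obtain ⟨δ, hδ, hfδ⟩ := huc ε hε
    refine forall_mem_Icc_of_short_steps hδ (fun η hη => ?_) fun a b ha hab hb hbδ iha η hη => ?_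
    · simp [wQuadSum_zero, hq0, hη]
    have haT : a ∈ Icc 0 T := ⟨ha, hab.trans hb⟩
    have hbT : b ∈ Icc 0 T := ⟨ha.trans hab, hb⟩
    set c := g (x a)
    have hlim := (hqv b hbT).sub (hqv a haT)
    have hlim₁ : Tendsto (fun n => ε * (quadSum (P.k n) (P.τ n) x b - quadSum (P.k n) (P.τ n) x a) +
        |c * (quadSum (P.k n) (P.τ n) x b - quadSum (P.k n) (P.τ n) x a - (q b - q a))|) atTop
        (nhds (ε * (q b - q a))) := by
      simpa using (hlim.const_mul ε).add ((hlim.sub_const (q b - q a)).const_mul c).abs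
    obtain ⟨N, hN⟩ := P.mesh δ hδ
    filter_upwards [iha (η / 2) (half_pos hη), eventually_ge_atTop N,
      hlim₁.eventually_lt_const (lt_add_of_pos_right _ (half_pos hη))] with n hna hnN hnq
    have hW := abs_wQuadSum_sub_sub_mul_le (k := P.k n) (τ := P.τ n) (g := g) (x := x) (c := c)
      (ε := ε) hab fun j hj hja hjb => by
        have hτ := P.mem_Icc_s8 n hj.le
        have hmesh := hN n hnN j hj
        have hlt := P.mono n (mem_Iic.2 hj.le) (mem_Iic.2 hj) (Nat.lt_succ_self j)
        refine hfδ _ hτ _ haT ?_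
        rw [Real.dist_eq, abs_le]
        constructor <;> linarith
    have hI := abs_setIntegral_sub_mul_le (c := c) (ε := ε) (hμ_top a b hab)
      (hint a b ha hb) fun u hu => by
        refine hfδ _ ⟨ha.trans hu.1.le, hu.2.trans hb⟩ _ haT ?_
        rw [Real.dist_eq, abs_le]
        constructor <;> linarith [hu.1, hu.2]
    rw [hμ_real a b hab] at hI
    have hsplit : ∫ u in Ioc 0 b, g (x u) ∂μq =
        ∫ u in Ioc 0 a, g (x u) ∂μq + ∫ u in Ioc a b, g (x u) ∂μq := by
      rw [← Ioc_union_Ioc_eq_Ioc ha hab]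
      exact setIntegral_union (Ioc_disjoint_Ioc_of_le le_rfl) measurableSet_Ioc
        (hint 0 a le_rfl haT.2) (hint a b ha hb)
    rw [hsplit]
    rw [mul_sub, mul_sub] at hnq
    rw [abs_lt] at hna ⊢
    rw [abs_le] at hW hI
    have h₁ := le_abs_self
      (c * (quadSum (P.k n) (P.τ n) x b - quadSum (P.k n) (P.τ n) x a) - c * (q b - q a))
    have h₂ := neg_abs_le
      (c * (quadSum (P.k n) (P.τ n) x b - quadSum (P.k n) (P.τ n) x a) - c * (q b - q a))
    constructor <;> linarith [hna.1, hna.2, hW.1, hW.2, hI.1, hI.2]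
  rw [Metric.tendsto_nhds]
  intro r hr
  have hqt : 0 ≤ q t := hq0 ▸ hq_mono ht.1
  have hε : 0 < r / (4 * (q t + 1)) := by positivity
  filter_upwards [main _ hε t ht (r / 2) (half_pos hr)] with n hn
  rw [Real.dist_eq]
  refine hn.trans_le ?_
  have : r / (4 * (q t + 1)) * (4 * (q t + 1)) = r := div_mul_cancel₀ _ (by positivity)
  linarith
end

section
/- Let T > 0, let (πₙ) be a sequence of partitions of [0,T] with mesh |πₙ| → 0, let w : [0,T] → ℝ be a continuous path with quadratic variation q(t) = ε² t (for some ε > 0, after scaling: equivalently, w has quadratic variation t ↦ t and we consider εw) along (πₙ), and let z : [0,T] → ℝ be a continuous path with zero quadratic variation along (πₙ). Let σ > 0 and μ ∈ ℝ, and define the mixed-model price path S(t) = exp(ε w(t) + σ z(t) + μ t) where w has quadratic variation t ↦ t along (πₙ). Then S has quadratic variation along (πₙ) given by [S](t) = ∫₀^t ε² S(s)² ds; that is, for every t ∈ [0,T], Σ_{t_j^n ∈ πₙ ∩ (0,t]} (S(t_j^n) − S(t_{j−1}^n))² → ∫₀^t ε² S(s)² ds as n → ∞. -/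
open Filter MeasureTheory Set

namespace PartitionSeq

variable {T : ℝ} (P : PartitionSeq T)

lemma τ_mem_Icc {n j : ℕ} (hj : j ≤ P.k n) : P.τ n j ∈ Icc 0 T := by
  have h := (P.mono n).monotoneOn
  constructor
  · rw [← P.first n]
    exact h (mem_Iic.2 (Nat.zero_le _)) (mem_Iic.2 hj) (Nat.zero_le _)
  · exact (h (mem_Iic.2 hj) (mem_Iic.2 le_rfl) hj).trans_eq (P.last n)

lemma τ_lt_succ {n j : ℕ} (hj : j < P.k n) : P.τ n j < P.τ n (j + 1) :=
  P.mono n (mem_Iic.2 hj.le) (mem_Iic.2 hj) (Nat.lt_succ_self j)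

/-- The sum of the weights `c j` attached to the partition intervals that end by time `t`. -/
noncomputable def cutSum (n : ℕ) (c : ℕ → ℝ) (t : ℝ) : ℝ :=
  ∑ j ∈ Finset.range (P.k n), if P.τ n (j + 1) ≤ t then c j else 0

lemma cutSum_eq_filter (n : ℕ) (c : ℕ → ℝ) (t : ℝ) :
    P.cutSum n c t = ∑ j ∈ (Finset.range (P.k n)).filter (fun j => P.τ n (j + 1) ≤ t), c j :=
  (Finset.sum_filter _ _).symm

lemma quadSum_eq_cutSum (n : ℕ) (x : ℝ → ℝ) (t : ℝ) :
    quadSum (P.k n) (P.τ n) x t =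
      P.cutSum n (fun j => (x (P.τ n (j + 1)) - x (P.τ n j)) ^ 2) t := rfl

lemma cutSum_zero (n : ℕ) (c : ℕ → ℝ) : P.cutSum n c 0 = 0 := by
  refine Finset.sum_eq_zero fun j hj => if_neg ?_
  have hj := Finset.mem_range.1 hj
  exact not_le.2 ((P.τ_mem_Icc hj.le).1.trans_lt (P.τ_lt_succ hj))

lemma cutSum_mono {n : ℕ} {c d : ℕ → ℝ} {t : ℝ} (h : ∀ j < P.k n, c j ≤ d j) :
    P.cutSum n c t ≤ P.cutSum n d t := by
  refine Finset.sum_le_sum fun j hj => ?_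
  have := h j (Finset.mem_range.1 hj)
  split_ifs <;> simp [this]

lemma cutSum_nonneg {n : ℕ} {c : ℕ → ℝ} {t : ℝ} (h : ∀ j, 0 ≤ c j) : 0 ≤ P.cutSum n c t := by
  rw [cutSum_eq_filter]
  exact Finset.sum_nonneg fun j _ => h j

/-- Along the partitions, the increments of a continuous path are eventually uniformly small. -/
lemma eventually_increment_le {f : ℝ → ℝ} (hf : ContinuousOn f (Icc 0 T)) {δ : ℝ} (hδ : 0 < δ) :
    ∀ᶠ n in atTop, ∀ j < P.k n, |f (P.τ n (j + 1)) - f (P.τ n j)| ≤ δ := by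
  obtain ⟨η, hη, h⟩ := Metric.uniformContinuousOn_iff.1
    (isCompact_Icc.uniformContinuousOn_of_continuous hf) δ hδ
  obtain ⟨N, hN⟩ := P.mesh η hη
  filter_upwards [eventually_ge_atTop N] with n hn j hj
  refine (h _ (P.τ_mem_Icc hj) _ (P.τ_mem_Icc hj.le) ?_).le
  rw [Real.dist_eq, abs_of_pos (sub_pos.2 (P.τ_lt_succ hj))]
  exact hN n hn j hj

/-- The identity path has zero quadratic variation. -/
lemma tendsto_quadSum_id (t : ℝ) :
    Tendsto (fun n => quadSum (P.k n) (P.τ n) id t) atTop (nhds 0) := by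
  have hT : 0 ≤ T := by
    have := P.τ_mem_Icc (n := 0) (j := 0) (Nat.zero_le _)
    exact this.1.trans this.2
  refine Metric.tendsto_nhds.2 fun e he => ?_
  have hd : 0 < e / (T + 1) := by positivity
  filter_upwards [P.eventually_increment_le continuousOn_id hd] with n hn
  have h0 : 0 ≤ quadSum (P.k n) (P.τ n) id t :=
    P.cutSum_nonneg fun j => sq_nonneg _
  rw [Real.dist_eq, sub_zero, abs_of_nonneg h0]
  calc quadSum (P.k n) (P.τ n) id t
      ≤ ∑ j ∈ Finset.range (P.k n), e / (T + 1) * (P.τ n (j + 1) - P.τ n j) := by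
        refine Finset.sum_le_sum fun j hj => ?_
        have hj := Finset.mem_range.1 hj
        have h1 := sub_pos.2 (P.τ_lt_succ hj)
        have h2 := (le_abs_self _).trans (hn j hj)
        simp only [id] at h2 ⊢
        split_ifs
        · rw [sq]; gcongr
        · positivity
    _ = e / (T + 1) * T := by
        rw [← Finset.mul_sum, Finset.sum_range_sub, P.first, P.last, sub_zero]
    _ < e := by
        rw [div_mul_eq_mul_div, div_lt_iff₀ (by positivity)]
        nlinarith

/-- On a time interval where the sampled weight is `δ`-close to a constant `A`, the weighted sum
is close to `A` times the unweighted one. -/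
lemma abs_cutSum_sub_le {n : ℕ} {c g : ℕ → ℝ} {a b A δ : ℝ} (hab : a ≤ b) (hc : ∀ j, 0 ≤ c j)
    (hg : ∀ j < P.k n, a < P.τ n (j + 1) → P.τ n (j + 1) ≤ b → |g j - A| ≤ δ) :
    |P.cutSum n (fun j => g j * c j) b - P.cutSum n (fun j => g j * c j) a
      - A * (P.cutSum n c b - P.cutSum n c a)| ≤ δ * (P.cutSum n c b - P.cutSum n c a) := by
  simp only [cutSum, ← Finset.sum_sub_distrib, Finset.mul_sum]
  refine (Finset.abs_sum_le_sum_abs _ _).trans (Finset.sum_le_sum fun j hj => ?_)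
  have hj := Finset.mem_range.1 hj
  by_cases h1 : P.τ n (j + 1) ≤ a
  · simp [h1, h1.trans hab]
  · by_cases h2 : P.τ n (j + 1) ≤ b
    · simp only [h1, h2, if_true, if_false, sub_zero]
      rw [← sub_mul, abs_mul, abs_of_nonneg (hc j)]
      exact mul_le_mul_of_nonneg_right (hg j hj (not_le.1 h1) h2) (hc j)
    · simp [h1, h2]

/-- If the distribution functions of nonnegative weights converge to that of Lebesgue measure,
then weighted left Riemann sums of a continuous function converge to its integral. -/
lemma tendsto_cutSum_mul_integral {f : ℝ → ℝ} (hf : ContinuousOn f (Icc 0 T))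
    {c : ℕ → ℕ → ℝ} (hc : ∀ n j, 0 ≤ c n j)
    (hlim : ∀ t ∈ Icc (0 : ℝ) T, Tendsto (fun n => P.cutSum n (c n) t) atTop (nhds t))
    {t : ℝ} (ht : t ∈ Icc 0 T) :
    Tendsto (fun n => P.cutSum n (fun j => f (P.τ n j) * c n j) t) atTop
      (nhds (∫ s in (0 : ℝ)..t, f s)) := by
  refine Metric.tendsto_nhds.2 fun e he => ?_
  have ht0 : 0 ≤ t := ht.1
  set δ := e / (2 * t + 3) with hδ_def
  have hδ : 0 < δ := by positivity
  have hδe : δ * (2 * t + 3) = e := div_mul_cancel₀ _ (by positivity)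
  obtain ⟨η, hη, hu⟩ := Metric.uniformContinuousOn_iff.1
    (isCompact_Icc.uniformContinuousOn_of_continuous hf) δ hδ
  obtain ⟨N, hN⟩ := P.mesh (η / 2) (by positivity)
  obtain ⟨m, hm⟩ := exists_nat_gt (t / (η / 2))
  have hm0 : (0 : ℝ) < m := lt_of_le_of_lt (by positivity) hm
  have hstep : t / m < η / 2 := by
    rw [div_lt_iff₀ (by positivity)] at hm
    rw [div_lt_iff₀ hm0]; linarith
  set s : ℕ → ℝ := fun i => i * (t / m) with hs_def
  have hs0 : s 0 = 0 := by simp [hs_def]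
  have hsm : s m = t := by simp only [hs_def]; field_simp
  have hs_succ (i : ℕ) : s (i + 1) = s i + t / m := by
    simp only [hs_def]; push_cast; ring
  have hstep0 : 0 ≤ t / m := by positivity
  have hs_mem {i : ℕ} (hi : i ≤ m) : s i ∈ Icc 0 T := by
    refine ⟨by positivity, le_trans ?_ ht.2⟩
    rw [← hsm]
    simp only [hs_def]
    gcongr
  have hmid : Tendsto (fun n => ∑ i ∈ Finset.range m,
      f (s i) * ((P.cutSum n (c n) (s (i + 1)) - P.cutSum n (c n) (s i)) - (s (i + 1) - s i)))
      atTop (nhds 0) := by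
    rw [← Finset.sum_const_zero (s := Finset.range m)]
    refine tendsto_finsetSum _ fun i hi => ?_
    have hi := Finset.mem_range.1 hi
    have := (((hlim _ (hs_mem hi)).sub (hlim _ (hs_mem hi.le))).sub_const
      (s (i + 1) - s i)).const_mul (f (s i))
    simpa using this
  filter_upwards [eventually_ge_atTop N, Metric.tendsto_nhds.1 hmid δ hδ,
    (hlim t ht).eventually_lt_const (lt_add_one t)] with n hn hmid hQ
  rw [Real.dist_eq, sub_zero] at hmid
  set L := fun u => P.cutSum n (fun j => f (P.τ n j) * c n j) u with hL
  set Q := fun u => P.cutSum n (c n) u with hQ_def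
  have hLQ : |∑ i ∈ Finset.range m, ((L (s (i + 1)) - L (s i))
      - f (s i) * (Q (s (i + 1)) - Q (s i)))| ≤ δ * Q t := by
    calc _ ≤ ∑ i ∈ Finset.range m, δ * (Q (s (i + 1)) - Q (s i)) := by
          refine (Finset.abs_sum_le_sum_abs _ _).trans (Finset.sum_le_sum fun i hi => ?_)
          have hi := Finset.mem_range.1 hi
          refine P.abs_cutSum_sub_le (by rw [hs_succ]; linarith) (hc n) fun j hj h1 h2 => ?_
          refine (hu _ (P.τ_mem_Icc hj.le) _ (hs_mem hi.le) ?_).le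
          have h3 := hN n hn j hj
          have h4 := P.τ_lt_succ hj
          rw [hs_succ] at h2
          rw [Real.dist_eq, abs_lt]
          constructor <;> linarith
      _ = δ * Q t := by
          rw [← Finset.mul_sum, Finset.sum_range_sub (fun i => Q (s i)), hsm, hs0]
          simp [hQ_def, P.cutSum_zero]
  have hfi {a b : ℝ} (ha : a ∈ Icc 0 T) (hb : b ∈ Icc 0 T) : IntervalIntegrable f volume a b :=
    (hf.mono (uIcc_subset_Icc ha hb)).intervalIntegrable
  have hint : |∑ i ∈ Finset.range m, ((∫ u in s i..s (i + 1), f u)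
      - f (s i) * (s (i + 1) - s i))| ≤ δ * t := by
    calc _ ≤ ∑ i ∈ Finset.range m, δ * (s (i + 1) - s i) := by
          refine (Finset.abs_sum_le_sum_abs _ _).trans (Finset.sum_le_sum fun i hi => ?_)
          have hi := Finset.mem_range.1 hi
          have hle : s i ≤ s (i + 1) := by rw [hs_succ]; linarith
          have h1 : (∫ u in s i..s (i + 1), f u) - f (s i) * (s (i + 1) - s i)
              = ∫ u in s i..s (i + 1), (f u - f (s i)) := by
            rw [intervalIntegral.integral_sub (hfi (hs_mem hi.le) (hs_mem hi))
              intervalIntegrable_const, intervalIntegral.integral_const, smul_eq_mul, mul_comm]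
          rw [h1, ← abs_of_nonneg (sub_nonneg.2 hle), ← Real.norm_eq_abs (∫ u in _.._, _)]
          refine intervalIntegral.norm_integral_le_of_norm_le_const fun u hu' => ?_
          rw [uIoc_of_le hle, hs_succ] at hu'
          refine (hu u ⟨(hs_mem hi.le).1.trans hu'.1.le, ?_⟩ _ (hs_mem hi.le) ?_).le
          · rw [← hs_succ] at hu'
            exact hu'.2.trans (hs_mem hi).2
          · rw [Real.dist_eq, abs_lt]
            constructor <;> linarith [hu'.1, hu'.2]
      _ = δ * t := by
          rw [← Finset.mul_sum, Finset.sum_range_sub, hsm, hs0, sub_zero]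
  have hdecomp : L t - ∫ u in (0 : ℝ)..t, f u
      = (∑ i ∈ Finset.range m, ((L (s (i + 1)) - L (s i)) - f (s i) * (Q (s (i + 1)) - Q (s i))))
        + (∑ i ∈ Finset.range m, f (s i) * ((Q (s (i + 1)) - Q (s i)) - (s (i + 1) - s i)))
        - ∑ i ∈ Finset.range m, ((∫ u in s i..s (i + 1), f u) - f (s i) * (s (i + 1) - s i)) := by
    have h1 : L t = ∑ i ∈ Finset.range m, (L (s (i + 1)) - L (s i)) := by
      rw [Finset.sum_range_sub (fun i => L (s i)), hsm, hs0]
      simp [hL, P.cutSum_zero]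
    have h2 : ∫ u in (0 : ℝ)..t, f u = ∑ i ∈ Finset.range m, ∫ u in s i..s (i + 1), f u := by
      rw [intervalIntegral.sum_integral_adjacent_intervals
        fun i hi => hfi (hs_mem (le_of_lt hi)) (hs_mem hi), hsm, hs0]
    rw [h1, h2, ← Finset.sum_add_distrib, ← Finset.sum_sub_distrib, ← Finset.sum_sub_distrib]
    exact Finset.sum_congr rfl fun i _ => by ring
  have hQδ : δ * Q t ≤ δ * (t + 1) := mul_le_mul_of_nonneg_left hQ.le hδ.le
  change |L t - _| < e
  rw [hdecomp, ← hδe]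
  rw [abs_le] at hLQ hint
  rw [abs_lt] at hmid ⊢
  constructor <;> nlinarith [hLQ.1, hLQ.2, hint.1, hint.2, hmid.1, hmid.2]

/-- Perturbing increments by a square-negligible remainder does not affect the limit of the sum
of squares. -/
lemma tendsto_cutSum_add_sq {a r : ℕ → ℕ → ℝ} {t A : ℝ}
    (ha : Tendsto (fun n => P.cutSum n (fun j => a n j ^ 2) t) atTop (nhds A))
    (hr : Tendsto (fun n => P.cutSum n (fun j => r n j ^ 2) t) atTop (nhds 0)) :
    Tendsto (fun n => P.cutSum n (fun j => (a n j + r n j) ^ 2) t) atTop (nhds A) := by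
  have hcross : Tendsto (fun n => P.cutSum n (fun j => a n j * r n j) t) atTop (nhds 0) := by
    have hsqrt : Tendsto (fun n => √(P.cutSum n (fun j => a n j ^ 2) t
        * P.cutSum n (fun j => r n j ^ 2) t)) atTop (nhds 0) := by
      simpa using (ha.mul hr).sqrt
    refine squeeze_zero_norm (fun n => ?_) hsqrt
    refine Real.abs_le_sqrt ?_
    simp only [cutSum_eq_filter]
    exact Finset.sum_mul_sq_le_sq_mul_sq _ _ _
  have := (ha.add (hcross.const_mul 2)).add hr
  simp only [mul_zero, add_zero] at this
  refine this.congr fun n => ?_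
  simp only [cutSum_eq_filter, Finset.mul_sum, ← Finset.sum_add_distrib]
  exact Finset.sum_congr rfl fun j _ => by ring

end PartitionSeq

/-- The remainder in replacing the increment of `exp` by a part `u` of its first-order
approximation `u + v + d`. -/
lemma sq_exp_remainder_le {E M δ u v d : ℝ} (hE : E ^ 2 ≤ M) (hδ : δ ≤ 1)
    (h : |u + v + d| ≤ δ) :
    (E * (Real.exp (u + v + d) - 1) - E * u) ^ 2
      ≤ 6 * M * δ ^ 2 * u ^ 2 + 10 * M * (v ^ 2 + d ^ 2) := by
  set x := u + v + d with hx
  have hM : 0 ≤ M := (sq_nonneg E).trans hE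
  have hδ0 : 0 ≤ δ := (abs_nonneg x).trans h
  have hδ2 : δ ^ 2 ≤ 1 := pow_le_one₀ hδ0 hδ
  have hx2 : x ^ 2 ≤ δ ^ 2 := sq_le_sq' (abs_le.1 h).1 (abs_le.1 h).2
  have hexp : (Real.exp x - 1 - x) ^ 2 ≤ δ ^ 2 * x ^ 2 := by
    have h1 := abs_le.1 (Real.abs_exp_sub_one_sub_id_le (h.trans hδ))
    calc (Real.exp x - 1 - x) ^ 2 ≤ (x ^ 2) ^ 2 := sq_le_sq' h1.1 h1.2
      _ = x ^ 2 * x ^ 2 := by ring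
      _ ≤ δ ^ 2 * x ^ 2 := by gcongr
  have hx3 : x ^ 2 ≤ 3 * (u ^ 2 + v ^ 2 + d ^ 2) := by
    rw [hx]; nlinarith [sq_nonneg (u - v), sq_nonneg (u - d), sq_nonneg (v - d)]
  have hvd : (v + d) ^ 2 ≤ 2 * (v ^ 2 + d ^ 2) := by nlinarith [sq_nonneg (v - d)]
  have hvd' : δ ^ 2 * (v ^ 2 + d ^ 2) ≤ 1 * (v ^ 2 + d ^ 2) := by gcongr
  have hin : (Real.exp x - 1 - u) ^ 2 ≤ 6 * δ ^ 2 * u ^ 2 + 10 * (v ^ 2 + d ^ 2) := by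
    have h1 : (Real.exp x - 1 - u) ^ 2
        ≤ 2 * (Real.exp x - 1 - x) ^ 2 + 2 * (v + d) ^ 2 := by
      have : Real.exp x - 1 - u = (Real.exp x - 1 - x) + (v + d) := by rw [hx]; ring
      rw [this]; exact (add_sq_le).trans_eq (by ring)
    have h2 := mul_le_mul_of_nonneg_left hx3 (sq_nonneg δ)
    nlinarith
  calc (E * (Real.exp x - 1) - E * u) ^ 2 = E ^ 2 * (Real.exp x - 1 - u) ^ 2 := by ring
    _ ≤ M * (6 * δ ^ 2 * u ^ 2 + 10 * (v ^ 2 + d ^ 2)) := by gcongr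
    _ = _ := by ring

/-- Quadratic variation of the mixed-model price path: if `w` is a continuous
path with quadratic variation `t ↦ t` along the partition sequence `P`, `z` is
a continuous path with zero quadratic variation along `P`, and
`S t = exp (ε * w t + σ * z t + μ * t)` with `ε, σ > 0`, then `S` has
quadratic variation `[S] t = ∫₀^t ε² (S s)² ds` along `P`. -/
theorem mixed_model_quadratic_variation
    (T : ℝ) (hT : 0 < T) (P : PartitionSeq T)
    (w z : ℝ → ℝ)
    (hw : ContinuousOn w (Set.Icc 0 T)) (hz : ContinuousOn z (Set.Icc 0 T))
    (hwqv : ∀ t ∈ Set.Icc (0 : ℝ) T,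
      Tendsto (fun n => quadSum (P.k n) (P.τ n) w t) atTop (nhds t))
    (hzqv : ∀ t ∈ Set.Icc (0 : ℝ) T,
      Tendsto (fun n => quadSum (P.k n) (P.τ n) z t) atTop (nhds 0))
    (ε σ μ : ℝ) (hε : 0 < ε) (hσ : 0 < σ)
    (S : ℝ → ℝ) (hS : ∀ t, S t = Real.exp (ε * w t + σ * z t + μ * t))
    (t : ℝ) (ht : t ∈ Set.Icc 0 T) :
    Tendsto (fun n => quadSum (P.k n) (P.τ n) S t) atTop
      (nhds (∫ s in (0 : ℝ)..t, ε ^ 2 * S s ^ 2)) := by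
  set X : ℝ → ℝ := fun s => ε * w s + σ * z s + μ * s with hX_def
  have hX : ContinuousOn X (Icc 0 T) := by fun_prop
  have hS' : S = fun s => Real.exp (X s) := funext hS
  have hSc : ContinuousOn S (Icc 0 T) := by rw [hS']; exact hX.rexp
  obtain ⟨M, hM⟩ := (isCompact_Icc.bddAbove_image (hSc.pow 2))
  have hM' {s : ℝ} (hs : s ∈ Icc 0 T) : S s ^ 2 ≤ M := hM ⟨s, hs, rfl⟩
  have hmain := P.tendsto_cutSum_mul_integral
    (f := fun s => ε ^ 2 * S s ^ 2) (continuousOn_const.mul (hSc.pow 2))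
    (c := fun n j => (w (P.τ n (j + 1)) - w (P.τ n j)) ^ 2) (fun n j => sq_nonneg _) hwqv ht
  set u : ℕ → ℕ → ℝ := fun n j => ε * (w (P.τ n (j + 1)) - w (P.τ n j)) with hu
  set r : ℕ → ℕ → ℝ := fun n j =>
    S (P.τ n (j + 1)) - S (P.τ n j) - S (P.τ n j) * u n j with hr_def
  have hr : Tendsto (fun n => P.cutSum n (fun j => r n j ^ 2) t) atTop (nhds 0) := by
    refine Metric.tendsto_nhds.2 fun e he => ?_
    have hM0 : 0 ≤ M := (sq_nonneg _).trans (hM' ht)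
    obtain ⟨δ, hδ0, hδ1, hδ⟩ : ∃ δ : ℝ, 0 < δ ∧ δ ≤ 1 ∧ 6 * M * δ ^ 2 * ε ^ 2 * t < e := by
      have hlim : Tendsto (fun δ : ℝ => 6 * M * δ ^ 2 * ε ^ 2 * t) (nhds 0) (nhds 0) :=
        Continuous.tendsto' (by fun_prop) _ _ (by simp)
      obtain ⟨δ, h1, h2⟩ := (((hlim.eventually_lt_const he).filter_mono
        nhdsWithin_le_nhds).and (Ioc_mem_nhdsGT zero_lt_one)).exists
      exact ⟨δ, h2.1, h2.2, h1⟩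
    have hbound := ((hwqv t ht).const_mul (6 * M * δ ^ 2 * ε ^ 2)).add
      (((hzqv t ht).const_mul (10 * M * σ ^ 2)).add
        ((P.tendsto_quadSum_id t).const_mul (10 * M * μ ^ 2)))
    simp only [mul_zero, add_zero] at hbound
    filter_upwards [hbound.eventually_lt_const hδ, P.eventually_increment_le hX hδ0]
      with n hn hinc
    rw [Real.dist_eq, sub_zero, abs_of_nonneg (P.cutSum_nonneg fun j => sq_nonneg _)]
    refine lt_of_le_of_lt ?_ hn
    simp only [P.quadSum_eq_cutSum]
    calc P.cutSum n (fun j => r n j ^ 2) t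
        ≤ P.cutSum n (fun j => 6 * M * δ ^ 2 * ε ^ 2 * (w (P.τ n (j + 1)) - w (P.τ n j)) ^ 2
          + (10 * M * σ ^ 2 * (z (P.τ n (j + 1)) - z (P.τ n j)) ^ 2
            + 10 * M * μ ^ 2 * (id (P.τ n (j + 1)) - id (P.τ n j)) ^ 2)) t := by
          refine P.cutSum_mono fun j hj => ?_
          have hXd : X (P.τ n (j + 1)) - X (P.τ n j) = u n j
              + σ * (z (P.τ n (j + 1)) - z (P.τ n j)) + μ * (P.τ n (j + 1) - P.τ n j) := by
            simp only [hX_def, hu]; ring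
          have hinc := hinc j hj
          rw [hXd] at hinc
          have hrj : r n j = S (P.τ n j) * (Real.exp (u n j
              + σ * (z (P.τ n (j + 1)) - z (P.τ n j)) + μ * (P.τ n (j + 1) - P.τ n j)) - 1)
              - S (P.τ n j) * u n j := by
            simp only [hr_def, hS']
            rw [← hXd, mul_sub, ← Real.exp_add, add_sub_cancel, mul_one]
          rw [hrj]
          refine (sq_exp_remainder_le (hM' (P.τ_mem_Icc hj.le)) hδ1 hinc).trans_eq ?_
          simp only [hu, id]
          ring
      _ = _ := by
          simp only [PartitionSeq.cutSum_eq_filter, Finset.sum_add_distrib, Finset.mul_sum]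
  have hfin := P.tendsto_cutSum_add_sq (a := fun n j => S (P.τ n j) * u n j) (r := r)
    (hmain.congr fun n => ?_) hr
  · refine hfin.congr fun n => ?_
    rw [P.quadSum_eq_cutSum]
    congr 1
    funext j
    simp only [hr_def]
    ring
  · congr 1
    funext j
    simp only [hu]
    ring
end
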